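/- arXiv:1504.06499 — 4 statements merged into one kernel-verified Lean document; each statement's English description precedes it below -/
import Mathlib

section
/- Let c₄₀, c₃₁, c₂₂, c₁₃, c₀₄ be real numbers. Define f(x,y) = y² + x²y + c₄₀x⁴ + c₃₁x³y + c₂₂x²y² + c₁₃xy³ + c₀₄y⁴ and g(x,y) = y² + x²y + c₄₀x⁴ + c₃₁x³y. Set q₁(x,y,z) = x − (1/2)c₁₃z, q₂(x,y,z) = y + c₂₂z, q₃(x,y,z) = z, and p(x,y,z) = 1 + 2c₂₂y + (c₀₄ + c₂₂²)z. Then the function (x,y) ↦ q₃(x,y,g(x,y))/p(x,y,g(x,y)) − f(q₁(x,y,g(x,y))/p(x,y,g(x,y)), q₂(x,y,g(x,y))/p(x,y,g(x,y))) is o(‖(x,y)‖⁴) as (x,y) → (0,0). Hence the 4-jets of the Monge forms z = f and z = g at the origin are projectively equivalent. -/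
open Asymptotics

/-- Rescaled numerator of the error term. -/
noncomputable def remR (c40 c31 m c13 c04 n a b : ℝ) : ℝ :=
  let k := c13 / 2
  let e := c04 + m ^ 2
  let τ := a ^ 2 * b + n * (c40 * a ^ 4 + c31 * a ^ 3 * b)
  let c := b ^ 2 + n * τ
  let σ := 2 * m * b + e * n * c
  let ξ := a - k * n * c
  let η := b + m * n * c
  let υ := τ + n * c04 * c ^ 2
  τ * (c04 * (c + b ^ 2) + c13 * a * b - m * a ^ 2)
    + σ ^ 2 * υ
    + 4 * m * b * (c40 * a ^ 4 + c31 * a ^ 3 * b) + 2 * e * c * τ + 2 * σ * c04 * c ^ 2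
    + 2 * k * m * a * c ^ 2 - k ^ 2 * c ^ 2 * η
    - σ * c * (m * a ^ 2 - 2 * k * a * η + k ^ 2 * n * c * η) - e * c * a ^ 2 * b
    - (c40 * (-k * c * (ξ + a) * (ξ ^ 2 + a ^ 2))
      + c31 * (ξ ^ 3 * m * c - k * c * b * (ξ ^ 2 + ξ * a + a ^ 2))
      + m * ((m * a * c - k * c * η) * (ξ * η + a * b))
      + c13 * (ξ * m * c * (η ^ 2 + η * b + b ^ 2) - k * c * b ^ 3)
      + c04 * (m * c * (η + b) * (η ^ 2 + b ^ 2)))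

/-- Numerator of the error term. -/
noncomputable def numN (c40 c31 m c13 c04 x y : ℝ) : ℝ :=
  let z := y ^ 2 + x ^ 2 * y + c40 * x ^ 4 + c31 * x ^ 3 * y
  let p := 1 + 2 * m * y + (c04 + m ^ 2) * z
  let X := x - (1 / 2) * c13 * z
  let Y := y + m * z
  z * p ^ 3 - (Y ^ 2 * p ^ 2 + X ^ 2 * Y * p + c40 * X ^ 4 + c31 * X ^ 3 * Y
    + m * X ^ 2 * Y ^ 2 + c13 * X * Y ^ 3 + c04 * Y ^ 4)

set_option maxHeartbeats 4000000 in
lemma numN_eq (c40 c31 m c13 c04 n a b : ℝ) :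
    numN c40 c31 m c13 c04 (n * a) (n * b) = n ^ 5 * remR c40 c31 m c13 c04 n a b := by
  simp only [numN, remR]
  obtain ⟨τ, hτ⟩ : ∃ τ, τ = a ^ 2 * b + n * (c40 * a ^ 4 + c31 * a ^ 3 * b) := ⟨_, rfl⟩
  obtain ⟨c, hc⟩ : ∃ c, c = b ^ 2 + n * τ := ⟨_, rfl⟩
  have hz : (n * b) ^ 2 + (n * a) ^ 2 * (n * b) + c40 * (n * a) ^ 4
      + c31 * (n * a) ^ 3 * (n * b) = n ^ 2 * c := by
    rw [hc, hτ]; ring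
  rw [hz, ← hτ, ← hc]
  clear hz
  subst hc
  subst hτ
  ring

lemma numN_isBigO (c40 c31 m c13 c04 : ℝ) :
    (fun P : ℝ × ℝ => numN c40 c31 m c13 c04 P.1 P.2)
      =O[nhds (0 : ℝ × ℝ)] (fun P : ℝ × ℝ => ‖P‖ ^ 5) := by
  have hcont : Continuous (fun q : ℝ × ℝ × ℝ => remR c40 c31 m c13 c04 q.1 q.2.1 q.2.2) := by
    unfold remR
    fun_prop
  obtain ⟨C, hC⟩ := (isCompact_closedBall (0 : ℝ × ℝ × ℝ) 1).exists_bound_of_continuousOn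
    hcont.continuousOn
  refine IsBigO.of_bound C ?_
  filter_upwards [Metric.closedBall_mem_nhds (0 : ℝ × ℝ) one_pos] with P hP
  have hP1 : ‖P‖ ≤ 1 := by simpa using hP
  have hx : |P.1| ≤ ‖P‖ := norm_fst_le P
  have hy : |P.2| ≤ ‖P‖ := norm_snd_le P
  by_cases h0 : ‖P‖ = 0
  · have : P = 0 := norm_eq_zero.mp h0
    subst this
    simp [numN]
  have hpos : 0 < ‖P‖ := lt_of_le_of_ne (norm_nonneg _) (Ne.symm h0)
  have ha : |P.1 / ‖P‖| ≤ 1 := by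
    rw [abs_div, abs_norm]; exact (div_le_one hpos).mpr hx
  have hb : |P.2 / ‖P‖| ≤ 1 := by
    rw [abs_div, abs_norm]; exact (div_le_one hpos).mpr hy
  have key := numN_eq c40 c31 m c13 c04 ‖P‖ (P.1 / ‖P‖) (P.2 / ‖P‖)
  rw [mul_div_cancel₀ _ h0, mul_div_cancel₀ _ h0] at key
  have hb' := hC (‖P‖, P.1 / ‖P‖, P.2 / ‖P‖) (by
    rw [mem_closedBall_zero_iff]
    simp only [Prod.norm_def, sup_le_iff]
    refine ⟨?_, ?_, ?_⟩
    · rw [Real.norm_eq_abs, ← Prod.norm_def, abs_norm]; exact hP1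
    · exact ha
    · exact hb)
  rw [key, norm_mul, mul_comm]
  simp only at hb'
  gcongr

/-- the 4-jets of the Monge forms `z = f` and `z = g` at the origin are
projectively equivalent via the explicit projective transformation `(q₁/p, q₂/p, q₃/p)`. -/
theorem stmt2 (c40 c31 c22 c13 c04 : ℝ) :
    let f : ℝ → ℝ → ℝ := fun x y =>
      y ^ 2 + x ^ 2 * y + c40 * x ^ 4 + c31 * x ^ 3 * y + c22 * x ^ 2 * y ^ 2
        + c13 * x * y ^ 3 + c04 * y ^ 4
    let g : ℝ → ℝ → ℝ := fun x y => y ^ 2 + x ^ 2 * y + c40 * x ^ 4 + c31 * x ^ 3 * y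
    let q1 : ℝ → ℝ → ℝ → ℝ := fun x _ z => x - (1 / 2) * c13 * z
    let q2 : ℝ → ℝ → ℝ → ℝ := fun _ y z => y + c22 * z
    let q3 : ℝ → ℝ → ℝ → ℝ := fun _ _ z => z
    let p : ℝ → ℝ → ℝ → ℝ := fun _ y z => 1 + 2 * c22 * y + (c04 + c22 ^ 2) * z
    (fun P : ℝ × ℝ =>
        q3 P.1 P.2 (g P.1 P.2) / p P.1 P.2 (g P.1 P.2)
          - f (q1 P.1 P.2 (g P.1 P.2) / p P.1 P.2 (g P.1 P.2))
              (q2 P.1 P.2 (g P.1 P.2) / p P.1 P.2 (g P.1 P.2)))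
      =o[nhds (0 : ℝ × ℝ)] (fun P : ℝ × ℝ => ‖P‖ ^ 4) := by
  intro f g q1 q2 q3 p
  have hp : ContinuousAt (fun P : ℝ × ℝ => p P.1 P.2 (g P.1 P.2)) 0 := by
    simp only [p, g]
    fun_prop
  have hp0 : p (0 : ℝ × ℝ).1 (0 : ℝ × ℝ).2 (g (0 : ℝ × ℝ).1 (0 : ℝ × ℝ).2) ≠ 0 := by
    simp [p, g]
  have hinv : (fun P : ℝ × ℝ => ((p P.1 P.2 (g P.1 P.2))⁻¹) ^ 4)
      =O[nhds (0 : ℝ × ℝ)] (fun _ => (1 : ℝ)) :=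
    ((hp.inv₀ hp0).pow 4).tendsto.isBigO_one ℝ
  have hbig := (numN_isBigO c40 c31 c22 c13 c04).mul hinv
  have hlo : (fun P : ℝ × ℝ => ‖P‖ ^ 5 * (1 : ℝ)) =o[nhds (0 : ℝ × ℝ)]
      (fun P : ℝ × ℝ => ‖P‖ ^ 4) := by
    have h1 : (fun P : ℝ × ℝ => ‖P‖) =o[nhds (0 : ℝ × ℝ)] (fun _ => (1 : ℝ)) := by
      rw [isLittleO_one_iff]
      exact tendsto_norm_zero
    have := (isBigO_refl (fun P : ℝ × ℝ => ‖P‖ ^ 4) (nhds 0)).mul_isLittleO h1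
    refine this.congr (fun P => by ring) (fun P => by ring)
  refine (hbig.trans_isLittleO hlo).congr' ?_ Filter.EventuallyEq.rfl
  filter_upwards [hp.eventually_ne hp0] with P hP
  have hN : numN c40 c31 c22 c13 c04 P.1 P.2
      = g P.1 P.2 * (p P.1 P.2 (g P.1 P.2)) ^ 3
        - ((q2 P.1 P.2 (g P.1 P.2)) ^ 2 * (p P.1 P.2 (g P.1 P.2)) ^ 2
          + (q1 P.1 P.2 (g P.1 P.2)) ^ 2 * q2 P.1 P.2 (g P.1 P.2) * p P.1 P.2 (g P.1 P.2)
          + c40 * (q1 P.1 P.2 (g P.1 P.2)) ^ 4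
          + c31 * (q1 P.1 P.2 (g P.1 P.2)) ^ 3 * q2 P.1 P.2 (g P.1 P.2)
          + c22 * (q1 P.1 P.2 (g P.1 P.2)) ^ 2 * (q2 P.1 P.2 (g P.1 P.2)) ^ 2
          + c13 * q1 P.1 P.2 (g P.1 P.2) * (q2 P.1 P.2 (g P.1 P.2)) ^ 3
          + c04 * (q2 P.1 P.2 (g P.1 P.2)) ^ 4) := rfl
  rw [hN]
  have h3 : q3 P.1 P.2 (g P.1 P.2) = g P.1 P.2 := rfl
  rw [h3]
  simp only [f]
  generalize p P.1 P.2 (g P.1 P.2) = p' at hP ⊢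
  generalize q1 P.1 P.2 (g P.1 P.2) = X
  generalize q2 P.1 P.2 (g P.1 P.2) = Y
  generalize g P.1 P.2 = z
  field_simp
  try ring
end

section
/- Let c₄₀, c₃₁ be real numbers with c₄₀ ≠ 1. Define f(x,y) = y² + x²y + c₄₀x⁴ + c₃₁x³y and g(x,y) = y² + x²y + c₄₀x⁴. Then there exist real numbers u₁, u₂, u₃, v₁, v₂, v₃, c, w₁, w₂, w₃ with c(u₁v₂ − u₂v₁) ≠ 0 such that, setting q₁ = u₁x + u₂y + u₃z, q₂ = v₁x + v₂y + v₃z, q₃ = cz, p = 1 + w₁x + w₂y + w₃z, the function (x,y) ↦ q₃(x,y,g(x,y))/p(x,y,g(x,y)) − f(q₁(x,y,g(x,y))/p(x,y,g(x,y)), q₂(x,y,g(x,y))/p(x,y,g(x,y))) is o(‖(x,y)‖⁴) as (x,y) → (0,0); that is, the 4-jets of the Monge forms z = f and z = g are projectively equivalent. -/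
open Asymptotics
set_option linter.unusedVariables false

def MM (C x y z : ℝ) (i j l : ℕ) : ℝ := C * (x ^ i * y ^ j * z ^ l)

def co003 (a k u w : ℝ) : ℝ := ((3)*w*w + (-72)*a*a*a*a*w + (144)*a*a*a*a*k*w + (-72)*a*a*a*a*k*k*w + (-6)*a*a*u*u + (6)*a*a*k*u*u)

def co004 (a k u w : ℝ) : ℝ := ((1)*w*w*w + (-36)*a*a*a*a*w*w + (72)*a*a*a*a*k*w*w + (-36)*a*a*a*a*k*k*w*w + (-6)*a*a*u*u*w + (6)*a*a*k*u*u*w + (-1)*k*u*u*u*u + (-24)*a*a*a*u*u*u + (48)*a*a*a*k*u*u*u + (-24)*a*a*a*k*k*u*u*u)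

def co012 (a k u w : ℝ) : ℝ := ((54)*a*a*w + (-48)*a*a*k*w + (-936)*a*a*a*a*a*a + (2736)*a*a*a*a*a*a*k + (-2664)*a*a*a*a*a*a*k*k + (864)*a*a*a*a*a*a*k*k*k + (-12)*a*a*a*u + (12)*a*a*a*k*u + (-1)*u*u)

def co013 (a k u w : ℝ) : ℝ := ((27)*a*a*w*w + (-24)*a*a*k*w*w + (-936)*a*a*a*a*a*a*w + (2736)*a*a*a*a*a*a*k*w + (-2664)*a*a*a*a*a*a*k*k*w + (864)*a*a*a*a*a*a*k*k*k*w + (-12)*a*a*a*u*w + (12)*a*a*a*k*u*w + (-1)*u*u*w + (-150)*a*a*a*a*u*u + (294)*a*a*a*a*k*u*u + (-144)*a*a*a*a*k*k*u*u + (-4)*a*u*u*u)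

def co022 (a k u w : ℝ) : ℝ := ((189)*a*a*a*a*w + (-330)*a*a*a*a*k*w + (144)*a*a*a*a*k*k*w + (-1)*w*w + (-6084)*a*a*a*a*a*a*a*a + (23400)*a*a*a*a*a*a*a*a*k + (-33732)*a*a*a*a*a*a*a*a*k*k + (21600)*a*a*a*a*a*a*a*a*k*k*k + (-5184)*a*a*a*a*a*a*a*a*k*k*k*k + (-2)*a*u*w + (-228)*a*a*a*a*a*u + (444)*a*a*a*a*a*k*u + (-216)*a*a*a*a*a*k*k*u + (-25)*a*a*u*u + (18)*a*a*k*u*u)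

def co031 (a k u w : ℝ) : ℝ := ((67)*a*a*a*a*a*a + (-114)*a*a*a*a*a*a*k + (48)*a*a*a*a*a*a*k*k + (-27)*a*a*w + (24)*a*a*k*w + (-38)*a*a*a*u + (32)*a*a*a*k*u)

def co102 (a k u w : ℝ) : ℝ := ((12)*a*w + (-144)*a*a*a*a*a + (288)*a*a*a*a*a*k + (-144)*a*a*a*a*a*k*k + (-12)*a*a*u + (12)*a*a*k*u)

def co103 (a k u w : ℝ) : ℝ := ((6)*a*w*w + (-144)*a*a*a*a*a*w + (288)*a*a*a*a*a*k*w + (-144)*a*a*a*a*a*k*k*w + (-12)*a*a*u*w + (12)*a*a*k*u*w + (-84)*a*a*a*u*u + (156)*a*a*a*k*u*u + (-4)*k*u*u*u + (-72)*a*a*a*k*k*u*u)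

def co112 (a k u w : ℝ) : ℝ := ((96)*a*a*a*w + (-84)*a*a*a*k*w + (-1872)*a*a*a*a*a*a*a + (5472)*a*a*a*a*a*a*a*k + (-5328)*a*a*a*a*a*a*a*k*k + (1728)*a*a*a*a*a*a*a*k*k*k + (-2)*u*w + (-324)*a*a*a*a*u + (612)*a*a*a*a*k*u + (-288)*a*a*a*a*k*k*u + (-14)*a*u*u)

def co121 (a k u w : ℝ) : ℝ := ((150)*a*a*a*a*a + (-216)*a*a*a*a*a*k + (72)*a*a*a*a*a*k*k + (-6)*a*w + (-54)*a*a*u + (36)*a*a*k*u)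

def co202 (a k u w : ℝ) : ℝ := ((6)*a*a*w + (-144)*a*a*a*a*a*a + (288)*a*a*a*a*a*a*k + (-144)*a*a*a*a*a*a*k*k + (6)*a*a*k*w + (-96)*a*a*a*u + (168)*a*a*a*k*u + (-6)*k*u*u + (-72)*a*a*a*k*k*u)

def co211 (a k u w : ℝ) : ℝ := ((-102)*a*a*a*a + (294)*a*a*a*a*k + (2)*w + (-180)*a*a*a*a*k*k + (-16)*a*u)

def co230 (a k u w : ℝ) : ℝ := ((153)*a*a*a*a + (-258)*a*a*a*a*k + (108)*a*a*a*a*k*k + (1)*w + (-2)*a*u)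

def co301 (a k u w : ℝ) : ℝ := ((-28)*a*a*a + (60)*a*a*a*k + (-4)*k*u + (-24)*a*a*a*k*k)

def co320 (a k u w : ℝ) : ℝ := ((96)*a*a*a + (-84)*a*a*a*k + (-2)*u)

def co401 (a k u w : ℝ) : ℝ := ((3)*k*w + (-36)*a*a*a*a*k + (72)*a*a*a*a*k*k + (-36)*a*a*a*a*k*k*k)

def co410 (a k u w : ℝ) : ℝ := ((6)*a*a + (33)*a*a*k + (-24)*a*a*k*k)

def co420 (a k u w : ℝ) : ℝ := ((153)*a*a*a*a*k + (-258)*a*a*a*a*k*k + (108)*a*a*a*a*k*k*k + (1)*k*w + (-2)*a*k*u)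

def co500 (a k u w : ℝ) : ℝ := ((6)*a*k)

def co510 (a k u w : ℝ) : ℝ := ((96)*a*a*a*k + (-84)*a*a*a*k*k + (-2)*k*u)

def co600 (a k u w : ℝ) : ℝ := ((6)*a*a*k + (6)*a*a*k*k)

def RR (a k u w x y z : ℝ) : ℝ :=
      MM (co003 a k u w) x y z 0 0 3
      + MM (co004 a k u w) x y z 0 0 4
      + MM (co012 a k u w) x y z 0 1 2
      + MM (co013 a k u w) x y z 0 1 3
      + MM (co022 a k u w) x y z 0 2 2
      + MM (co031 a k u w) x y z 0 3 1
      + MM (co102 a k u w) x y z 1 0 2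
      + MM (co103 a k u w) x y z 1 0 3
      + MM (co112 a k u w) x y z 1 1 2
      + MM (co121 a k u w) x y z 1 2 1
      + MM (co202 a k u w) x y z 2 0 2
      + MM (co211 a k u w) x y z 2 1 1
      + MM (co230 a k u w) x y z 2 3 0
      + MM (co301 a k u w) x y z 3 0 1
      + MM (co320 a k u w) x y z 3 2 0
      + MM (co401 a k u w) x y z 4 0 1
      + MM (co410 a k u w) x y z 4 1 0
      + MM (co420 a k u w) x y z 4 2 0
      + MM (co500 a k u w) x y z 5 0 0
      + MM (co510 a k u w) x y z 5 1 0
      + MM (co600 a k u w) x y z 6 0 0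

def GG (k : ℝ) (P : ℝ × ℝ) : ℝ := P.2 ^ 2 + P.1 ^ 2 * P.2 + k * P.1 ^ 4

lemma fst_bigO : (fun P : ℝ × ℝ => P.1) =O[nhds (0 : ℝ × ℝ)] (fun P : ℝ × ℝ => ‖P‖) :=
  IsBigO.of_bound 1 (Filter.Eventually.of_forall fun P => by simpa using norm_fst_le P)

lemma snd_bigO : (fun P : ℝ × ℝ => P.2) =O[nhds (0 : ℝ × ℝ)] (fun P : ℝ × ℝ => ‖P‖) :=
  IsBigO.of_bound 1 (Filter.Eventually.of_forall fun P => by simpa using norm_snd_le P)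

lemma pow_bigO {m n : ℕ} (h : n ≤ m) :
    (fun P : ℝ × ℝ => ‖P‖ ^ m) =O[nhds (0 : ℝ × ℝ)] (fun P : ℝ × ℝ => ‖P‖ ^ n) := by
  refine IsBigO.of_bound 1 ?_
  filter_upwards [Metric.ball_mem_nhds (0 : ℝ × ℝ) one_pos] with P hP
  have hP1 : ‖P‖ ≤ 1 := by
    have := mem_ball_zero_iff.mp hP
    exact this.le
  simpa using pow_le_pow_of_le_one (norm_nonneg P) hP1 h

lemma GG_bigO (k : ℝ) : GG k =O[nhds (0 : ℝ × ℝ)] (fun P : ℝ × ℝ => ‖P‖ ^ 2) := by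
  have h1 := snd_bigO.pow 2
  have h2 : (fun P : ℝ × ℝ => P.1 ^ 2 * P.2) =O[nhds (0 : ℝ × ℝ)] (fun P : ℝ × ℝ => ‖P‖ ^ 2) :=
    ((fst_bigO.pow 2).mul snd_bigO).trans
      ((pow_bigO (show 2 ≤ 3 by norm_num)).congr_left fun P => by ring)
  have h3 := ((fst_bigO.pow 4).const_mul_left k).trans (pow_bigO (show 2 ≤ 4 by norm_num))
  exact (h1.add h2).add h3

lemma mono_bigO (k C : ℝ) (i j l : ℕ) (h : 5 ≤ i + j + 2 * l) :
    (fun P : ℝ × ℝ => MM C P.1 P.2 (GG k P) i j l) =O[nhds (0 : ℝ × ℝ)]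
      (fun P : ℝ × ℝ => ‖P‖ ^ 5) := by
  refine IsBigO.trans ?_ (pow_bigO h)
  have := ((((fst_bigO.pow i).mul (snd_bigO.pow j)).mul ((GG_bigO k).pow l))).const_mul_left C
  refine this.congr_right fun P => ?_
  rw [← pow_mul, ← pow_add, ← pow_add]

set_option maxHeartbeats 4000000 in
lemma rem_bigO (a k u w : ℝ) :
    (fun P : ℝ × ℝ =>
      RR a k u w P.1 P.2 (GG k P)) =O[nhds (0 : ℝ × ℝ)] (fun P : ℝ × ℝ => ‖P‖ ^ 5) := by
  unfold RR
  repeat' refine IsBigO.add ?_ ?_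
  all_goals exact mono_bigO k _ _ _ _ (by norm_num)

set_option maxHeartbeats 4000000 in
lemma key_id (a k u w x y z : ℝ) (hz : z = y^2 + x^2*y + k*x^4)
    (hu : u = ((4)*a*a*a + (-4)*a*a*a*k) / 2) (hw : w = -((-33)*a*a*a*a + (69)*a*a*a*a*k + (-2)*a*u + (-36)*a*a*a*a*k*k)) :
    1*z*(1 + 2*a*x + (2*(6*a^2*(1-k))+a^2)*y + w*z)^3 - ((0*x+1*y+(6*a^2*(1-k))*z)^2*(1 + 2*a*x + (2*(6*a^2*(1-k))+a^2)*y + w*z)^2+(1*x+a*y+u*z)^2*(0*x+1*y+(6*a^2*(1-k))*z)*(1 + 2*a*x + (2*(6*a^2*(1-k))+a^2)*y + w*z)+k*(1*x+a*y+u*z)^4+4*a*(1-k)*(1*x+a*y+u*z)^3*(0*x+1*y+(6*a^2*(1-k))*z)) =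
      RR a k u w x y z := by
  have e1 : (-2)*u + ((4)*a*a*a + (-4)*a*a*a*k) = 0 := by rw [hu]; ring
  have e2 : w + ((-33)*a*a*a*a + (69)*a*a*a*a*k + (-2)*a*u + (-36)*a*a*a*a*k*k) = 0 := by linear_combination hw
  simp only [RR, MM, co003, co004, co012, co013, co022, co031, co102, co103, co112, co121, co202, co211, co230, co301, co320, co401, co410, co420, co500, co510, co600]
  subst hz
  linear_combination (x*y^3) * e1 + y^4 * e2

theorem stmt3 (c40 c31 : ℝ) (h : c40 ≠ 1) :
    let f : ℝ → ℝ → ℝ := fun x y => y ^ 2 + x ^ 2 * y + c40 * x ^ 4 + c31 * x ^ 3 * y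
    let g : ℝ → ℝ → ℝ := fun x y => y ^ 2 + x ^ 2 * y + c40 * x ^ 4
    ∃ u1 u2 u3 v1 v2 v3 c w1 w2 w3 : ℝ,
      c * (u1 * v2 - u2 * v1) ≠ 0 ∧
      (fun P : ℝ × ℝ =>
          (c * g P.1 P.2) / (1 + w1 * P.1 + w2 * P.2 + w3 * g P.1 P.2)
            - f ((u1 * P.1 + u2 * P.2 + u3 * g P.1 P.2)
                  / (1 + w1 * P.1 + w2 * P.2 + w3 * g P.1 P.2))
                ((v1 * P.1 + v2 * P.2 + v3 * g P.1 P.2)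
                  / (1 + w1 * P.1 + w2 * P.2 + w3 * g P.1 P.2)))
        =o[nhds (0 : ℝ × ℝ)] (fun P : ℝ × ℝ => ‖P‖ ^ 4) := by
  intro f g
  obtain ⟨k, hk⟩ : ∃ k, k = c40 := ⟨_, rfl⟩
  have hk1 : 1 - c40 ≠ 0 := sub_ne_zero.mpr (Ne.symm h)
  obtain ⟨a, ha⟩ : ∃ a, a = c31 / (4 * (1 - c40)) := ⟨_, rfl⟩
  have hc : c31 = 4 * a * (1 - k) := by rw [ha, hk]; field_simp
  obtain ⟨u, hu⟩ : ∃ u : ℝ, u = ((4)*a*a*a + (-4)*a*a*a*k) / 2 := ⟨_, rfl⟩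
  obtain ⟨w, hw⟩ : ∃ w : ℝ, w = -((-33)*a*a*a*a + (69)*a*a*a*a*k + (-2)*a*u + (-36)*a*a*a*a*k*k) := ⟨_, rfl⟩
  refine ⟨1, a, u, 0, 1, (6*a^2*(1-k)), 1, 2 * a, (2*(6*a^2*(1-k))+a^2), w, by norm_num, ?_⟩
  have hg : ∀ P : ℝ × ℝ, g P.1 P.2 = GG k P := fun P => by simp only [g, GG, hk]
  simp only [hg]
  have hN := (rem_bigO a k u w).congr_left fun P =>
    (key_id a k u w P.1 P.2 (GG k P) rfl hu hw).symm
  have hcont : Continuous fun P : ℝ × ℝ => (1 + 2*a*P.1 + (2*(6*a^2*(1-k))+a^2)*P.2 + w*GG k P) := by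
    unfold GG
    fun_prop
  have hp := hcont.tendsto 0
  have h0 : (1 + 2*a*(0 : ℝ × ℝ).1 + (2*(6*a^2*(1-k))+a^2)*(0 : ℝ × ℝ).2 + w*GG k (0 : ℝ × ℝ)) = 1 := by simp [GG]
  rw [h0] at hp
  have hinv := ((hp.pow 4).inv₀ (by norm_num)).isBigO_one ℝ
  have hlt : (fun P : ℝ × ℝ => ‖P‖ ^ 5) =o[nhds (0 : ℝ × ℝ)] (fun P : ℝ × ℝ => ‖P‖ ^ 4) := by
    have := (isLittleO_pow_pow (𝕜 := ℝ) (show 4 < 5 by norm_num)).comp_tendsto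
      (tendsto_norm_zero (E := ℝ × ℝ))
    exact this
  have hfin := (hN.mul hinv).congr_right (g₂ := fun P : ℝ × ℝ => ‖P‖ ^ 5) fun P => by simp
  refine (hfin.trans_isLittleO hlt).congr' ?_ Filter.EventuallyEq.rfl
  filter_upwards [hp.eventually_ne one_ne_zero] with P hP
  simp only [f, hc, ← hk]
  generalize (1 + 2*a*P.1 + (2*(6*a^2*(1-k))+a^2)*P.2 + w*GG k P) = p at hP ⊢
  field_simp
end

section
/- Let β be a nonzero real number. Define f(x,y) = y² + x²y + x⁴ + βx³y and g(x,y) = y² + x²y + x⁴. Then for ALL real numbers u₁, u₂, u₃, v₁, v₂, v₃, c, w₁, w₂, w₃ with c(u₁v₂ − u₂v₁) ≠ 0, setting q₁ = u₁x + u₂y + u₃z, q₂ = v₁x + v₂y + v₃z, q₃ = cz, p = 1 + w₁x + w₂y + w₃z, the function (x,y) ↦ q₃(x,y,g(x,y))/p(x,y,g(x,y)) − f(q₁(x,y,g(x,y))/p(x,y,g(x,y)), q₂(x,y,g(x,y))/p(x,y,g(x,y))) is NOT o(‖(x,y)‖⁴) as (x,y) → (0,0); that is, the term x³y cannot be removed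 by any projective transformation: the 4-jets of z = y² + x²y + x⁴ + βx³y and z = y² + x²y + x⁴ are not projectively equivalent. -/
open Asymptotics

/-- second order expansion with continuous remainder -/
def JetTwo (h : ℝ → ℝ) (a b d : ℝ) : Prop :=
  ∃ r : ℝ → ℝ, Continuous r ∧ ∀ t, h t = a + b * t + d * t ^ 2 + t ^ 3 * r t

lemma JetTwo.add {h k : ℝ → ℝ} {a b d a' b' d' : ℝ} (H : JetTwo h a b d)
    (K : JetTwo k a' b' d') : JetTwo (fun t => h t + k t) (a + a') (b + b') (d + d') := by
  obtain ⟨r, hr, e⟩ := H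
  obtain ⟨r', hr', e'⟩ := K
  exact ⟨fun t => r t + r' t, by fun_prop, fun t => by simp only [e, e']; ring⟩

lemma JetTwo.sub {h k : ℝ → ℝ} {a b d a' b' d' : ℝ} (H : JetTwo h a b d)
    (K : JetTwo k a' b' d') : JetTwo (fun t => h t - k t) (a - a') (b - b') (d - d') := by
  obtain ⟨r, hr, e⟩ := H
  obtain ⟨r', hr', e'⟩ := K
  exact ⟨fun t => r t - r' t, by fun_prop, fun t => by simp only [e, e']; ring⟩

lemma JetTwo.mul {h k : ℝ → ℝ} {a b d a' b' d' : ℝ} (H : JetTwo h a b d)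
    (K : JetTwo k a' b' d') :
    JetTwo (fun t => h t * k t) (a * a') (a * b' + b * a') (a * d' + b * b' + d * a') := by
  obtain ⟨r, hr, e⟩ := H
  obtain ⟨r', hr', e'⟩ := K
  refine ⟨fun t => (b * d' + d * b') + d * d' * t + (a + b * t + d * t ^ 2) * r' t
    + r t * (a' + b' * t + d' * t ^ 2) + t ^ 3 * r t * r' t, by fun_prop, fun t => ?_⟩
  simp only [e, e']; ring

lemma JetTwo.const (a : ℝ) : JetTwo (fun _ => a) a 0 0 :=
  ⟨fun _ => 0, by fun_prop, fun t => by ring⟩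

lemma JetTwo.id : JetTwo (fun t => t) 0 1 0 :=
  ⟨fun _ => 0, by fun_prop, fun t => by ring⟩

lemma JetTwo.eq_zero {h : ℝ → ℝ} {a b d : ℝ} (H : JetTwo h a b d)
    (ho : (fun t => t ^ 2 * h t) =o[nhds (0 : ℝ)] (fun t => t ^ 4)) :
    a = 0 ∧ b = 0 ∧ d = 0 := by
  obtain ⟨r, hr, e⟩ := H
  have T := (ho.mono (nhdsWithin_le_nhds (s := {0}ᶜ))).tendsto_div_nhds_zero
  have ne : ∀ᶠ t : ℝ in nhdsWithin 0 {0}ᶜ, t ≠ 0 := eventually_mem_nhdsWithin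
  have key : ∀ (k : ℝ → ℝ) (m : ℝ → ℝ), Continuous k → Continuous m → m 0 = 0 →
      (∀ t, t ≠ 0 → k t = m t * (t ^ 2 * h t / t ^ 4)) → k 0 = 0 := by
    intro k m hk hm hm0 hkm
    have h1 : Filter.Tendsto k (nhdsWithin 0 {0}ᶜ) (nhds (k 0)) :=
      hk.continuousAt.tendsto.mono_left nhdsWithin_le_nhds
    have h2 : Filter.Tendsto m (nhdsWithin 0 {0}ᶜ) (nhds (m 0)) :=
      hm.continuousAt.tendsto.mono_left nhdsWithin_le_nhds
    have h3 := h2.mul T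
    rw [mul_zero] at h3
    refine tendsto_nhds_unique h1 (h3.congr' ?_)
    filter_upwards [ne] with t ht using (hkm t ht).symm
  have ha : a = 0 := by
    have := key (fun t => a + b * t + d * t ^ 2 + t ^ 3 * r t) (fun t => t ^ 2)
      (by fun_prop) (by fun_prop) (by simp) (fun t ht => by rw [e]; field_simp)
    simpa using this
  subst ha
  have hb : b = 0 := by
    have := key (fun t => b + d * t + t ^ 2 * r t) (fun t => t)
      (by fun_prop) (by fun_prop) (by simp) (fun t ht => by rw [e]; field_simp; ring)
    simpa using this
  subst hb
  refine ⟨rfl, rfl, ?_⟩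
  have h1 : Filter.Tendsto (fun t => d + t * r t) (nhdsWithin 0 {0}ᶜ) (nhds (d + 0 * r 0)) :=
    (show Continuous (fun t => d + t * r t) by fun_prop).continuousAt.tendsto.mono_left
      nhdsWithin_le_nhds
  rw [zero_mul, add_zero] at h1
  refine tendsto_nhds_unique h1 (T.congr' ?_)
  filter_upwards [ne] with t ht
  rw [e]; field_simp; ring

/-- for `β ≠ 0`, the term `x³y` cannot be removed by any projective
transformation: for every admissible transformation, the difference function is NOT
`o(‖(x,y)‖⁴)`, so the 4-jets of `z = y² + x²y + x⁴ + βx³y` and `z = y² + x²y + x⁴`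
are not projectively equivalent. -/
theorem stmt4 (β : ℝ) (hβ : β ≠ 0) :
    let f : ℝ → ℝ → ℝ := fun x y => y ^ 2 + x ^ 2 * y + x ^ 4 + β * x ^ 3 * y
    let g : ℝ → ℝ → ℝ := fun x y => y ^ 2 + x ^ 2 * y + x ^ 4
    ∀ u1 u2 u3 v1 v2 v3 c w1 w2 w3 : ℝ,
      c * (u1 * v2 - u2 * v1) ≠ 0 →
      ¬ ((fun P : ℝ × ℝ =>
          (c * g P.1 P.2) / (1 + w1 * P.1 + w2 * P.2 + w3 * g P.1 P.2)
            - f ((u1 * P.1 + u2 * P.2 + u3 * g P.1 P.2)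
                  / (1 + w1 * P.1 + w2 * P.2 + w3 * g P.1 P.2))
                ((v1 * P.1 + v2 * P.2 + v3 * g P.1 P.2)
                  / (1 + w1 * P.1 + w2 * P.2 + w3 * g P.1 P.2)))
        =o[nhds (0 : ℝ × ℝ)] (fun P : ℝ × ℝ => ‖P‖ ^ 4)) := by
  intro f g u1 u2 u3 v1 v2 v3 c w1 w2 w3 hc ho
  have main : ∀ s : ℝ,
      c * s ^ 2 - (v1 + v2 * s) ^ 2 = 0 ∧
      c * (s + 3 * s ^ 2 * (w1 + w2 * s)) - (2 * (v1 + v2 * s) * (v3 * s ^ 2)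
        + 2 * (v1 + v2 * s) ^ 2 * (w1 + w2 * s) + (u1 + u2 * s) ^ 2 * (v1 + v2 * s)) = 0 ∧
      c * (1 + 3 * s * (w1 + w2 * s) + s ^ 2 * (3 * (w1 + w2 * s) ^ 2 + 3 * w3 * s ^ 2))
        - ((v3 * s ^ 2) ^ 2 + 2 * (v1 + v2 * s) * (v3 * s)
          + 4 * (v1 + v2 * s) * (v3 * s ^ 2) * (w1 + w2 * s)
          + (v1 + v2 * s) ^ 2 * ((w1 + w2 * s) ^ 2 + 2 * w3 * s ^ 2)
          + (2 * (u1 + u2 * s) * (u3 * s ^ 2) * (v1 + v2 * s) + (u1 + u2 * s) ^ 2 * (v3 * s ^ 2)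
            + (u1 + u2 * s) ^ 2 * (v1 + v2 * s) * (w1 + w2 * s))
          + (u1 + u2 * s) ^ 4 + β * (u1 + u2 * s) ^ 3 * (v1 + v2 * s)) = 0 := by
    intro s
    have G : JetTwo (fun t => s * s + s * t + t * t) (s ^ 2) s 1 :=
      ⟨fun _ => 0, by fun_prop, fun t => by ring⟩
    have L : ∀ a b : ℝ, JetTwo (fun t => a + t * (b * (s * s + s * t + t * t)))
        a (b * s ^ 2) (b * s) :=
      fun a b => ⟨fun _ => b, by fun_prop, fun t => by ring⟩
    have Q1 := L (u1 + u2 * s) u3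
    have Q2 := L (v1 + v2 * s) v3
    have Pp := (JetTwo.const 1).add (JetTwo.id.mul (L (w1 + w2 * s) w3))
    have A := ((JetTwo.const c).mul G).mul (Pp.mul (Pp.mul Pp))
    have B1 := (Q2.mul Q2).mul (Pp.mul Pp)
    have B2 := JetTwo.id.mul (((Q1.mul Q1).mul Q2).mul Pp)
    have B3 := (JetTwo.id.mul JetTwo.id).mul ((Q1.mul Q1).mul (Q1.mul Q1))
    have B4 := (JetTwo.id.mul JetTwo.id).mul
      ((JetTwo.const β).mul ((Q1.mul (Q1.mul Q1)).mul Q2))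
    have J := A.sub (((B1.add B2).add B3).add B4)
    have ho' : (fun t : ℝ => t ^ 2 * (c * (s * s + s * t + t * t) * ((1 + t * (w1 + w2 * s + t * (w3 * (s * s + s * t + t * t)))) ^ 3)
          - ((v1 + v2 * s + t * (v3 * (s * s + s * t + t * t))) ^ 2
              * (1 + t * (w1 + w2 * s + t * (w3 * (s * s + s * t + t * t)))) ^ 2
            + t * ((u1 + u2 * s + t * (u3 * (s * s + s * t + t * t))) ^ 2
              * (v1 + v2 * s + t * (v3 * (s * s + s * t + t * t)))
              * (1 + t * (w1 + w2 * s + t * (w3 * (s * s + s * t + t * t)))))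
            + t ^ 2 * (u1 + u2 * s + t * (u3 * (s * s + s * t + t * t))) ^ 4
            + t ^ 2 * (β * (u1 + u2 * s + t * (u3 * (s * s + s * t + t * t))) ^ 3
              * (v1 + v2 * s + t * (v3 * (s * s + s * t + t * t))))))) =o[nhds (0 : ℝ)] (fun t => t ^ 4) := by
      have tl : Filter.Tendsto (fun t : ℝ => ((t, s * t) : ℝ × ℝ)) (nhds 0) (nhds 0) := by
        have : Continuous (fun t : ℝ => ((t, s * t) : ℝ × ℝ)) := by fun_prop
        have h0 := this.tendsto 0
        rw [mul_zero] at h0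
        exact h0
      have o1 := ho.comp_tendsto tl
      have o2 : ((fun P : ℝ × ℝ => ‖P‖ ^ 4) ∘ fun t : ℝ => ((t, s * t) : ℝ × ℝ))
          =O[nhds 0] (fun t : ℝ => t ^ 4) := by
        refine IsBigO.of_bound (‖((1 : ℝ), s)‖ ^ 4) (Filter.Eventually.of_forall fun t => ?_)
        have : ((t, s * t) : ℝ × ℝ) = t • ((1 : ℝ), s) := by
          ext <;> simp [mul_comm]
        simp only [Function.comp, this, norm_smul, norm_pow, norm_mul, norm_norm]
        exact le_of_eq (by ring)
      have o3 := o1.trans_isBigO o2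
      let p : ℝ → ℝ := fun t => 1 + w1 * t + w2 * (s * t) + w3 * g t (s * t)
      have pc : Continuous p := by simp only [p, g]; fun_prop
      have p0 : p 0 = 1 := by simp [p, g]
      have o4 : (fun t => p t ^ 4) =O[nhds 0] (fun _ : ℝ => (1 : ℝ)) :=
        ((pc.pow 4).tendsto 0).isBigO_one ℝ
      have o5 := o4.mul_isLittleO o3
      simp only [one_mul] at o5
      have pne : ∀ᶠ t in nhds 0, p t ≠ 0 :=
        pc.continuousAt.eventually_ne (by rw [p0]; exact one_ne_zero)
      refine IsLittleO.congr' o5 ?_ Filter.EventuallyEq.rfl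
      filter_upwards [pne] with t ht
      simp only [Function.comp, f]
      have ep : 1 + t * (w1 + w2 * s + t * (w3 * (s * s + s * t + t * t))) = p t := by
        simp only [p, g]; ring
      rw [ep]
      have e1 : u1 * t + u2 * (s * t) + u3 * g t (s * t)
          = t * (u1 + u2 * s + t * (u3 * (s * s + s * t + t * t))) := by
        simp only [g]; ring
      have e2 : v1 * t + v2 * (s * t) + v3 * g t (s * t)
          = t * (v1 + v2 * s + t * (v3 * (s * s + s * t + t * t))) := by
        simp only [g]; ring
      have e3 : g t (s * t) = t ^ 2 * (s * s + s * t + t * t) := by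
        simp only [g]; ring
      have e4 : 1 + w1 * t + w2 * (s * t) + w3 * g t (s * t) = p t := rfl
      rw [e1, e2, e4, e3]
      generalize u1 + u2 * s + t * (u3 * (s * s + s * t + t * t)) = X
      generalize v1 + v2 * s + t * (v3 * (s * s + s * t + t * t)) = Y
      generalize s * s + s * t + t * t = Z
      generalize p t = q at ht
      field_simp
      try ring
    obtain ⟨z1, z2, z3⟩ := J.eq_zero (ho'.congr_left (fun t => by ring))
    refine ⟨?_, ?_, ?_⟩
    · rw [← z1]; ring
    · rw [← z2]; ring
    · rw [← z3]; ring
  have a0 := main 0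
  have a1 := main 1
  have a2 := main (-1)
  have a3 := main 2
  have a4 := main (-2)
  have hv1 : v1 = 0 := by
    have := a0.1
    simpa using this
  subst hv1
  have hcv : c = v2 ^ 2 := by linarith [a1.1]
  have hc0 : c ≠ 0 := left_ne_zero_of_mul hc
  have hv2 : v2 ≠ 0 := by rintro rfl; simp at hcv; exact hc0 hcv
  have hu1 : u1 ≠ 0 := by rintro rfl; simp at hc
  have k1 : c = u1 ^ 2 * v2 := by
    linear_combination (8 * (a1.2.1 - a2.2.1) - (a3.2.1 - a4.2.1)) / 12
  have k2 : 3 * c * w1 = 2 * v2 ^ 2 * w1 + 2 * u1 * u2 * v2 := by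
    linear_combination (a1.2.1 + a2.2.1) / 2
  have k3 : 3 * c * w1 = u1 ^ 2 * v2 * w1 + 4 * u1 ^ 3 * u2 + β * u1 ^ 3 * v2 := by
    linear_combination (8 * (a1.2.2 - a2.2.2) - (a3.2.2 - a4.2.2)) / 12
  have hv : v2 = u1 ^ 2 := by
    apply mul_right_cancel₀ hv2
    linear_combination k1 - hcv
  rw [hcv, hv] at k2 k3
  have : β * u1 ^ 5 = 0 := by linear_combination 2 * k2 - k3
  exact mul_ne_zero hβ (pow_ne_zero 5 hu1) this
end

section
/- Let c₄₀, c₃₁, c₂₂, c₁₃, c₀₄ be real numbers. Define f(x,y) = xy + y³ + c₄₀x⁴ + c₃₁x³y + c₂₂x²y² + c₁₃xy³ + c₀₄y⁴ and g(x,y) = xy + y³ + c₄₀x⁴ + c₃₁x³y. Set q₁(x,y,z) = x + c₀₄z, q₂(x,y,z) = y − (1/2)c₁₃z, q₃(x,y,z) = z, and p(x,y,z) = 1 − (1/2)c₁₃x + c₀₄y + (c₂₂ − (1/2)c₁₃c₀₄)z. Then the function (x,y) ↦ q₃(x,y,g(x,y))/p(x,y,g(x,y)) − f(q₁(x,y,g(x,y))/p(x,y,g(x,y)),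 q₂(x,y,g(x,y))/p(x,y,g(x,y))) is o(‖(x,y)‖⁴) as (x,y) → (0,0). Hence the 4-jets of z = f and z = g at the origin are projectively equivalent. -/
open Asymptotics

/-- Rescaled remainder: the numerator of the order-four defect at `(t ξ, t η)` is `t ^ 5` times this. -/
theorem remainder_exists (c40 c31 c22 c13 c04 : ℝ) :
    ∃ M : ℝ × ℝ × ℝ → ℝ, Continuous M ∧ ∀ t X Y x y z p q r : ℝ, x = t * X → y = t * Y →
      z = x * y + y ^ 3 + c40 * x ^ 4 + c31 * x ^ 3 * y →
      p = 1 - (1 / 2) * c13 * x + c04 * y + (c22 - (1 / 2) * c13 * c04) * z →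
      q = x + c04 * z → r = y - (1 / 2) * c13 * z →
      z * p ^ 3 - (q * r * p ^ 2 + r ^ 3 * p + c40 * q ^ 4 + c31 * q ^ 3 * r
        + c22 * q ^ 2 * r ^ 2 + c13 * q * r ^ 3 + c04 * r ^ 4) = t ^ 5 * M (t, X, Y) := by
  let Q : ℝ × ℝ × ℝ → ℝ := fun v => c40 * v.2.1 ^ 4 + c31 * v.2.1 ^ 3 * v.2.2
  let W : ℝ × ℝ × ℝ → ℝ := fun v => v.2.2 ^ 3 + v.1 * Q v
  let Z : ℝ × ℝ × ℝ → ℝ := fun v => v.2.1 * v.2.2 + v.1 * W v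
  let U : ℝ × ℝ × ℝ → ℝ := fun v =>
    -((1 / 2) * c13) * v.2.1 + c04 * v.2.2 + (c22 - (1 / 2) * c13 * c04) * v.1 * Z v
  let S : ℝ × ℝ × ℝ → ℝ := fun v => -((1 / 2) * c13) * Z v
  let R : ℝ × ℝ × ℝ → ℝ := fun v => c04 * Z v
  let A : ℝ × ℝ × ℝ → ℝ := fun v => v.2.1 + v.1 * R v
  let B : ℝ × ℝ × ℝ → ℝ := fun v => v.2.2 + v.1 * S v
  have hQ : Continuous Q := by fun_prop
  have hW : Continuous W := by fun_prop
  have hZ : Continuous Z := by fun_prop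
  have hU : Continuous U := by fun_prop
  have hS : Continuous S := by fun_prop
  have hR : Continuous R := by fun_prop
  have hA : Continuous A := by fun_prop
  have hB : Continuous B := by fun_prop
  refine ⟨fun v => U v ^ 2 * v.2.2 ^ 3 + (2 * U v + v.1 * U v ^ 2) * (Q v + c22 * Z v ^ 2)
    + c22 * W v * (Z v + v.2.1 * v.2.2)
    - (3 * v.2.2 * S v ^ 2 + v.1 * S v ^ 3 - 3 * ((1 / 2) * c13) * v.2.2 ^ 2 * W v
      + U v * (3 * v.2.2 ^ 2 * S v + 3 * v.1 * v.2.2 * S v ^ 2 + v.1 ^ 2 * S v ^ 3)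
      - (c22 - (1 / 2) * c13 * c04) * Z v * v.2.2 ^ 3)
    - (c40 * (R v * (A v ^ 3 + A v ^ 2 * v.2.1 + A v * v.2.1 ^ 2 + v.2.1 ^ 3))
      + c31 * (R v * (A v ^ 2 + A v * v.2.1 + v.2.1 ^ 2) * B v + v.2.1 ^ 3 * S v)
      + c22 * (R v * (A v + v.2.1) * B v ^ 2 + v.2.1 ^ 2 * S v * (B v + v.2.2))
      + c13 * (R v * B v ^ 3 + v.2.1 * S v * (B v ^ 2 + B v * v.2.2 + v.2.2 ^ 2))
      + c04 * (S v * (B v ^ 3 + B v ^ 2 * v.2.2 + B v * v.2.2 ^ 2 + v.2.2 ^ 3))),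
    by fun_prop, ?_⟩
  intro t X Y x y z p q r hx hy hz hp hq hr
  have eW : W (t, X, Y) = Y ^ 3 + t * Q (t, X, Y) := rfl
  have eZ : Z (t, X, Y) = X * Y + t * W (t, X, Y) := rfl
  have eU : U (t, X, Y) = -((1 / 2) * c13) * X + c04 * Y
    + (c22 - (1 / 2) * c13 * c04) * t * Z (t, X, Y) := rfl
  have eS : S (t, X, Y) = -((1 / 2) * c13) * Z (t, X, Y) := rfl
  have eR : R (t, X, Y) = c04 * Z (t, X, Y) := rfl
  have eA : A (t, X, Y) = X + t * R (t, X, Y) := rfl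
  have eB : B (t, X, Y) = Y + t * S (t, X, Y) := rfl
  have eQ : Q (t, X, Y) = c40 * X ^ 4 + c31 * X ^ 3 * Y := rfl
  have hz' : z = t ^ 2 * Z (t, X, Y) := by
    rw [hz, eZ, eW, eQ, hx, hy]; ring
  have hp' : p = 1 + t * U (t, X, Y) := by
    rw [hp, eU, hz', hx, hy]; ring
  have hq' : q = t * A (t, X, Y) := by rw [hq, eA, eR, hz', hx]; ring
  have hr' : r = t * B (t, X, Y) := by rw [hr, eB, eS, hz', hy]; ring
  have key : z * p - q * r = t ^ 3 * Y ^ 3 + t ^ 4 * Q (t, X, Y) + c22 * t ^ 4 * Z (t, X, Y) ^ 2 := by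
    have h1 : z = x * y + t ^ 3 * W (t, X, Y) := by rw [hz', eZ, hx, hy]; ring
    have h2 : z * p - q * r = z - x * y + c22 * z ^ 2 := by rw [hp, hq, hr]; ring
    rw [h2]
    have h3 : z - x * y = t ^ 3 * W (t, X, Y) := by rw [h1]; ring
    rw [h3, hz', eW]; ring
  have split : z * p ^ 3 - (q * r * p ^ 2 + r ^ 3 * p + c40 * q ^ 4 + c31 * q ^ 3 * r
        + c22 * q ^ 2 * r ^ 2 + c13 * q * r ^ 3 + c04 * r ^ 4)
      = (z * p - q * r) * p ^ 2 - (r ^ 3 * p + c40 * q ^ 4 + c31 * q ^ 3 * r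
        + c22 * q ^ 2 * r ^ 2 + c13 * q * r ^ 3 + c04 * r ^ 4) := by ring
  rw [split, key, hp', hq', hr']
  dsimp only
  generalize Q (t, X, Y) = Q' at *
  generalize W (t, X, Y) = W' at *
  generalize Z (t, X, Y) = Z' at *
  generalize U (t, X, Y) = U' at *
  generalize S (t, X, Y) = S' at *
  generalize R (t, X, Y) = R' at *
  generalize A (t, X, Y) = A' at *
  generalize B (t, X, Y) = B' at *
  have e1 : c22 * t ^ 4 * Z' ^ 2 = c22 * t ^ 4 * X ^ 2 * Y ^ 2
      + t ^ 5 * (c22 * W' * (Z' + X * Y)) := by rw [eZ]; ring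
  have e2 : (t * B') ^ 3 * (1 + t * U') = t ^ 3 * Y ^ 3 + t ^ 4 * (U' * Y ^ 3)
      - t ^ 4 * (3 * ((1 / 2) * c13) * X * Y ^ 3) + t ^ 5 * (3 * Y * S' ^ 2 + t * S' ^ 3
      - 3 * ((1 / 2) * c13) * Y ^ 2 * W'
      + U' * (3 * Y ^ 2 * S' + 3 * t * Y * S' ^ 2 + t ^ 2 * S' ^ 3)) := by
    have : S' * Y ^ 2 = - ((1 / 2) * c13) * (X * Y ^ 3 + t * W' * Y ^ 2) := by rw [eS, eZ]; ring
    rw [eB]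
    linear_combination 3 * t ^ 4 * this
  have e3 : U' * Y ^ 3 = -((1 / 2) * c13) * X * Y ^ 3 + c04 * Y ^ 4
      + t * ((c22 - (1 / 2) * c13 * c04) * Z' * Y ^ 3) := by rw [eU]; ring
  have eA' : t * R' = A' - X := by rw [eA]; ring
  have eB' : t * S' = B' - Y := by rw [eB]; ring
  have f1 : A' ^ 4 = X ^ 4 + t * (R' * (A' ^ 3 + A' ^ 2 * X + A' * X ^ 2 + X ^ 3)) := by
    linear_combination -(A' ^ 3 + A' ^ 2 * X + A' * X ^ 2 + X ^ 3) * eA'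
  have f2 : A' ^ 3 * B' = X ^ 3 * Y + t * (R' * (A' ^ 2 + A' * X + X ^ 2) * B' + X ^ 3 * S') := by
    linear_combination -(A' ^ 2 + A' * X + X ^ 2) * B' * eA' - X ^ 3 * eB'
  have f3 : A' ^ 2 * B' ^ 2 = X ^ 2 * Y ^ 2
      + t * (R' * (A' + X) * B' ^ 2 + X ^ 2 * S' * (B' + Y)) := by
    linear_combination -(A' + X) * B' ^ 2 * eA' - X ^ 2 * (B' + Y) * eB'
  have f4 : A' * B' ^ 3 = X * Y ^ 3
      + t * (R' * B' ^ 3 + X * S' * (B' ^ 2 + B' * Y + Y ^ 2)) := by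
    linear_combination -B' ^ 3 * eA' - X * (B' ^ 2 + B' * Y + Y ^ 2) * eB'
  have f5 : B' ^ 4 = Y ^ 4 + t * (S' * (B' ^ 3 + B' ^ 2 * Y + B' * Y ^ 2 + Y ^ 3)) := by
    linear_combination -(B' ^ 3 + B' ^ 2 * Y + B' * Y ^ 2 + Y ^ 3) * eB'
  linear_combination e1 - e2 + t ^ 4 * e3 + t ^ 4 * eQ - t ^ 4 * c40 * f1 - t ^ 4 * c31 * f2
    - t ^ 4 * c22 * f3 - t ^ 4 * c13 * f4 - t ^ 4 * c04 * f5

/-- the 4-jets of `z = f` and `z = g` at the origin are projectively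
equivalent via the explicit transformation `(q₁/p, q₂/p, q₃/p)`. -/
theorem stmt6 (c40 c31 c22 c13 c04 : ℝ) :
    let f : ℝ → ℝ → ℝ := fun x y =>
      x * y + y ^ 3 + c40 * x ^ 4 + c31 * x ^ 3 * y + c22 * x ^ 2 * y ^ 2
        + c13 * x * y ^ 3 + c04 * y ^ 4
    let g : ℝ → ℝ → ℝ := fun x y => x * y + y ^ 3 + c40 * x ^ 4 + c31 * x ^ 3 * y
    let q1 : ℝ → ℝ → ℝ → ℝ := fun x _ z => x + c04 * z
    let q2 : ℝ → ℝ → ℝ → ℝ := fun _ y z => y - (1 / 2) * c13 * z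
    let q3 : ℝ → ℝ → ℝ → ℝ := fun _ _ z => z
    let p : ℝ → ℝ → ℝ → ℝ := fun x y z =>
      1 - (1 / 2) * c13 * x + c04 * y + (c22 - (1 / 2) * c13 * c04) * z
    (fun P : ℝ × ℝ =>
        q3 P.1 P.2 (g P.1 P.2) / p P.1 P.2 (g P.1 P.2)
          - f (q1 P.1 P.2 (g P.1 P.2) / p P.1 P.2 (g P.1 P.2))
              (q2 P.1 P.2 (g P.1 P.2) / p P.1 P.2 (g P.1 P.2)))
      =o[nhds (0 : ℝ × ℝ)] (fun P : ℝ × ℝ => ‖P‖ ^ 4) := by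
  intro f g q1 q2 q3 p
  obtain ⟨M, hM, hform⟩ := remainder_exists c40 c31 c22 c13 c04
  obtain ⟨C, hC⟩ := ((isCompact_Icc (a := (0:ℝ)) (b := 1)).prod
    ((isCompact_Icc (a := (-1:ℝ)) (b := 1)).prod
      (isCompact_Icc (a := (-1:ℝ)) (b := 1)))).exists_bound_of_continuousOn hM.continuousOn
  have hpc : Continuous (fun P : ℝ × ℝ => p P.1 P.2 (g P.1 P.2)) := by
    simp only [p, g]; fun_prop
  have hp1 : ∀ᶠ P : ℝ × ℝ in nhds 0, 1 / 2 < p P.1 P.2 (g P.1 P.2) := by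
    apply hpc.continuousAt.eventually_const_lt
    simp only [p, g]; norm_num
  have hn1 : ∀ᶠ P : ℝ × ℝ in nhds 0, ‖P‖ < 1 := by
    apply (continuous_norm (E := ℝ × ℝ)).continuousAt.eventually_lt_const
    simp
  have hO : (fun P : ℝ × ℝ =>
        q3 P.1 P.2 (g P.1 P.2) / p P.1 P.2 (g P.1 P.2)
          - f (q1 P.1 P.2 (g P.1 P.2) / p P.1 P.2 (g P.1 P.2))
              (q2 P.1 P.2 (g P.1 P.2) / p P.1 P.2 (g P.1 P.2)))
      =O[nhds (0 : ℝ × ℝ)] (fun P : ℝ × ℝ => ‖P‖ ^ 5) := by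
    apply IsBigO.of_bound (16 * C)
    filter_upwards [hp1, hn1] with P hP hP1
    obtain ⟨x, y⟩ := P
    have hxn : |x| ≤ ‖(x, y)‖ := norm_fst_le (x, y)
    have hyn : |y| ≤ ‖(x, y)‖ := norm_snd_le (x, y)
    have ht0 : 0 ≤ ‖(x, y)‖ := norm_nonneg _
    generalize ‖(x, y)‖ = t at *
    dsimp only at hP ⊢
    have hdiv : ∀ w : ℝ, |w| ≤ t → w = t * (w / t) ∧ w / t ∈ Set.Icc (-1 : ℝ) 1 := by
      intro w hw
      rcases ht0.eq_or_lt with h | h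
      · subst h
        have : w = 0 := abs_nonpos_iff.mp hw
        subst this; norm_num
      · refine ⟨by field_simp, abs_le.mp ?_⟩
        rw [abs_div, abs_of_pos h]
        exact (div_le_one h).mpr hw
    obtain ⟨hx, hX⟩ := hdiv x hxn
    obtain ⟨hy, hY⟩ := hdiv y hyn
    have hb := hC (t, x / t, y / t) ⟨⟨ht0, hP1.le⟩, hX, hY⟩
    have hf := hform t (x / t) (y / t) x y (g x y) (p x y (g x y)) (q1 x y (g x y))
      (q2 x y (g x y)) hx hy rfl rfl rfl rfl
    have hq3 : q3 x y (g x y) = g x y := rfl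
    rw [hq3]
    generalize p x y (g x y) = d at *
    generalize q1 x y (g x y) = a at *
    generalize q2 x y (g x y) = b at *
    generalize g x y = z at *
    have hd : d ≠ 0 := by linarith
    have hF : z / d - f (a / d) (b / d) = t ^ 5 * M (t, x / t, y / t) / d ^ 4 := by
      rw [← hf]; simp only [f]; field_simp
    rw [hF, norm_div, norm_mul, norm_pow, norm_pow, Real.norm_of_nonneg ht0,
      Real.norm_of_nonneg (by linarith : (0:ℝ) ≤ d), div_le_iff₀ (by positivity)]
    have hd4 : 1 ≤ 16 * d ^ 4 := by
      have : (1 / 2 : ℝ) ^ 4 ≤ d ^ 4 := pow_le_pow_left₀ (by norm_num) hP.le 4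
      linarith
    have hC0 : 0 ≤ C := (norm_nonneg _).trans hb
    have ht5 : 0 ≤ t ^ 5 := by positivity
    calc t ^ 5 * ‖M (t, x / t, y / t)‖ ≤ t ^ 5 * C := by gcongr
      _ ≤ t ^ 5 * C * (16 * d ^ 4) := le_mul_of_one_le_right (by positivity) hd4
      _ = 16 * C * t ^ 5 * d ^ 4 := by ring
  refine hO.trans_isLittleO ?_
  have h45 : (4 : ℕ) < 5 := by norm_num
  exact (isLittleO_pow_pow h45).comp_tendsto
    (by simpa using (continuous_norm (E := ℝ × ℝ)).tendsto 0)
end
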